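/- arXiv:2305.12929 — 5 statements merged into one kernel-verified Lean document; each statement's English description precedes it below -/
import Mathlib

section
/- Let r, c, n be integers with 0 ≤ r ≤ c ≤ n and n ≥ r + c. Let M be the C(n,r) × C(n,c) matrix over ℚ whose rows are indexed by r-element subsets R of {1,…,n} and columns by c-element subsets C of {1,…,n}, with (R,C)-entry equal to 1 if R ⊆ C and 0 otherwise. Let M* be the C(n,c) × C(n,r) matrix over ℚ whose (C,R)-entry equals (-1)^{r-i} · C(c-i-1, r-i) / ( C(n-r, c-r) · C(n-c, r-i) ), where i = |R ∩ C|. Then M·M* is the identity matrix of size C(n,r). -/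
open Finset in
/-- Summing over the `d`-subsets of a disjoint union a function of the size of the trace on the
first part. -/
lemma sum_powersetCard_union_card_inter {α : Type*} [DecidableEq α] {A B : Finset α}
    (hAB : Disjoint A B) (d : ℕ) (f : ℕ → ℚ) :
    ∑ D ∈ powersetCard d (A ∪ B), f (A ∩ D).card =
      ∑ p ∈ antidiagonal d, (A.card.choose p.1 : ℚ) * (B.card.choose p.2 : ℚ) * f p.1 := by
  have fiber : ∀ p ∈ antidiagonal d,
      (A.card.choose p.1 : ℚ) * (B.card.choose p.2 : ℚ) * f p.1 =
        ∑ _q ∈ powersetCard p.1 A ×ˢ powersetCard p.2 B, f p.1 := by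
    intro p _
    simp
  rw [sum_congr rfl fiber, sum_sigma']
  have hd := disjoint_left.1 hAB
  refine sum_bij' (fun D _ => ⟨((A ∩ D).card, (B ∩ D).card), (A ∩ D, B ∩ D)⟩)
    (fun x _ => x.2.1 ∪ x.2.2) ?_ ?_ ?_ ?_ ?_
  · intro D hD
    obtain ⟨hsub, hcard⟩ := mem_powersetCard.1 hD
    simp only [mem_sigma, HasAntidiagonal.mem_antidiagonal, mem_product, mem_powersetCard,
      inter_subset_left, and_self, and_true]
    rw [← card_union_of_disjoint
      (hAB.mono inter_subset_left inter_subset_left), ← union_inter_distrib_right,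
      inter_eq_right.2 hsub, hcard]
  · rintro ⟨⟨a, b⟩, S, T⟩ h
    simp only [mem_sigma, HasAntidiagonal.mem_antidiagonal, mem_product, mem_powersetCard] at h ⊢
    obtain ⟨hab, ⟨hS, hSa⟩, hT, hTb⟩ := h
    refine ⟨union_subset_union hS hT, ?_⟩
    rw [card_union_of_disjoint (hAB.mono hS hT), hSa, hTb, hab]
  · intro D hD
    obtain ⟨hsub, -⟩ := mem_powersetCard.1 hD
    simp only [← union_inter_distrib_right, inter_eq_right.2 hsub]
  · rintro ⟨⟨a, b⟩, S, T⟩ h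
    simp only [mem_sigma, HasAntidiagonal.mem_antidiagonal, mem_product, mem_powersetCard] at h
    obtain ⟨-, ⟨hS, rfl⟩, hT, rfl⟩ := h
    have hA : A ∩ (S ∪ T) = S := by grind
    have hB : B ∩ (S ∪ T) = T := by grind
    simp only [hA, hB]
  · intro D _
    rfl

open Finset in
/-- The supersets of `R` of size `c` correspond to the subsets of the complement of `R` of size
`c - R.card`. -/
lemma sum_filter_superset_eq_sum_powersetCard_compl {α : Type*} [Fintype α] [DecidableEq α]
    (R : Finset α) {c : ℕ} (hc : R.card ≤ c) (g : Finset α → ℚ) :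
    ∑ C ∈ (powersetCard c univ).filter (R ⊆ ·), g C =
      ∑ D ∈ powersetCard (c - R.card) Rᶜ, g (R ∪ D) := by
  refine sum_bij' (fun C _ => C \ R) (fun D _ => R ∪ D) ?_ ?_ ?_ ?_ ?_
  · intro C hC
    simp only [mem_filter, mem_powersetCard, subset_univ, true_and] at hC ⊢
    exact ⟨fun x hx => mem_compl.2 (mem_sdiff.1 hx).2, by rw [card_sdiff_of_subset hC.2, hC.1]⟩
  · intro D hD
    simp only [mem_filter, mem_powersetCard, subset_univ, true_and] at hD ⊢
    refine ⟨?_, subset_union_left⟩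
    rw [card_union_of_disjoint (disjoint_left.2 fun x hx hx' => mem_compl.1 (hD.1 hx') hx), hD.2]
    omega
  · intro C hC
    exact union_sdiff_of_subset (mem_filter.1 hC).2
  · intro D hD
    have hD' := (mem_powersetCard.1 hD).1
    exact union_sdiff_cancel_left (disjoint_left.2 fun x hx hx' => mem_compl.1 (hD' hx') hx)
  · intro C hC
    rw [union_sdiff_of_subset (mem_filter.1 hC).2]

open Finset in
/-- The coefficient of `x ^ j` in `(1 + x) ^ d * (1 + x) ^ (-d)`. -/
lemma sum_antidiagonal_choose_mul_neg_choose (d j : ℕ) :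
    ∑ p ∈ antidiagonal j,
      (d.choose p.1 : ℚ) * ((-1) ^ p.2 * ((d + p.2 - 1).choose p.2 : ℚ)) =
      if j = 0 then 1 else 0 := by
  have neg_choose : ∀ k : ℕ,
      Ring.choose (-(d : ℤ)) k = (-1) ^ k * ((d + k - 1).choose k : ℤ) := by
    intro k
    rcases Nat.eq_zero_or_pos k with rfl | hk
    · simp
    · rw [Ring.choose_neg, ← Ring.choose_natCast, Nat.cast_sub (by omega), Int.negOnePow_def]
      simp [Units.smul_def]
  have vandermonde := Ring.add_choose_eq j (Commute.all (d : ℤ) (-(d : ℤ)))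
  simp only [add_neg_cancel, Ring.choose_natCast, neg_choose, Ring.choose_zero_ite]
    at vandermonde
  exact_mod_cast vandermonde.symm

/-- Rearrangement of factorials in a product of binomial coefficients. -/
lemma choose_mul_choose_div_choose {m d j a : ℕ} (had : a ≤ d) (haj : a ≤ j) (hjd : j + d ≤ m) :
    (j.choose a : ℚ) * ((m - j).choose (d - a) : ℚ) / ((m - d).choose (j - a) : ℚ) =
      ((m - j).factorial * j.factorial / ((m - d).factorial * d.factorial) : ℚ) *
        (d.choose a : ℚ) := by
  rw [Nat.cast_choose ℚ haj, Nat.cast_choose ℚ had,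
    Nat.cast_choose ℚ (show d - a ≤ m - j by omega),
    Nat.cast_choose ℚ (show j - a ≤ m - d by omega),
    show m - j - (d - a) = m - d - (j - a) by omega]
  have := fun k : ℕ => (Nat.cast_ne_zero (R := ℚ)).2 k.factorial_ne_zero
  field_simp [this]

open Finset in
/-- Weighting the counts of `d`-subsets by their trace on a `j`-subset of an `m`-set. -/
lemma sum_antidiagonal_choose_mul_choose_mul_weight {m d j : ℕ} (hjd : j + d ≤ m) :
    ∑ p ∈ antidiagonal d, (j.choose p.1 : ℚ) * ((m - j).choose p.2 : ℚ) *
      ((-1) ^ (j - p.1) * ((d + (j - p.1) - 1).choose (j - p.1) : ℚ) /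
        ((m.choose d : ℚ) * ((m - d).choose (j - p.1) : ℚ))) =
      if j = 0 then 1 else 0 := by
  set K : ℚ := (m - j).factorial * j.factorial / ((m - d).factorial * d.factorial) with hK
  have term : ∀ a ∈ range (min d j + 1), (j.choose a : ℚ) * ((m - j).choose (d - a) : ℚ) *
      ((-1) ^ (j - a) * ((d + (j - a) - 1).choose (j - a) : ℚ) /
        ((m.choose d : ℚ) * ((m - d).choose (j - a) : ℚ))) =
      K / m.choose d * ((d.choose a : ℚ) *
        ((-1) ^ (j - a) * ((d + (j - a) - 1).choose (j - a) : ℚ))) := by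
    intro a ha
    rw [mem_range] at ha
    have key := choose_mul_choose_div_choose (m := m) (d := d) (j := j) (a := a)
      (by omega) (by omega) hjd
    rw [← hK] at key
    linear_combination
      ((-1) ^ (j - a) * ((d + (j - a) - 1).choose (j - a) : ℚ) / (m.choose d : ℚ)) * key
  have convolution := sum_antidiagonal_choose_mul_neg_choose d j
  rw [Nat.sum_antidiagonal_eq_sum_range_succ_mk] at convolution ⊢
  rw [← sum_subset (s₁ := range (min d j + 1)) (by grind)] at convolution ⊢
  · rw [sum_congr rfl term, ← mul_sum, convolution]
    split_ifs with hj
    · subst hj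
      have := fun k : ℕ => (Nat.cast_ne_zero (R := ℚ)).2 k.factorial_ne_zero
      rw [hK, Nat.cast_choose ℚ (show d ≤ m by omega)]
      field_simp [this]
      simp
    · simp
  · intro a ha ha'
    rw [mem_range] at ha ha'
    simp [Nat.choose_eq_zero_of_lt (show j < a by omega)]
  · intro a ha ha'
    rw [mem_range] at ha ha'
    simp [Nat.choose_eq_zero_of_lt (show d < a by omega)]

/-- Let `0 ≤ r ≤ c ≤ n` with `n ≥ r + c`.  Let `M` be the set inclusion incidence matrix,
whose rows are indexed by `r`-subsets `R` of `{1,…,n}` and whose columns are indexed by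
`c`-subsets `C`, with `(R,C)`-entry `1` if `R ⊆ C` and `0` otherwise.  Let `M*` be the matrix
with `(C,R)`-entry `(-1)^(r-i) · C(c-i-1, r-i) / (C(n-r, c-r) · C(n-c, r-i))`, where
`i = |R ∩ C|`.  Then `M · M* = I`. -/
theorem set_inclusion_mul_star_eq_one (r c n : ℕ) (hrc : r ≤ c) (hcn : c ≤ n)
    (hn : r + c ≤ n)
    (M : Matrix {S : Finset (Fin n) // S.card = r} {S : Finset (Fin n) // S.card = c} ℚ)
    (hM : ∀ R C, M R C = if (R : Finset (Fin n)) ⊆ (C : Finset (Fin n)) then 1 else 0)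
    (Mstar : Matrix {S : Finset (Fin n) // S.card = c} {S : Finset (Fin n) // S.card = r} ℚ)
    (hMstar : ∀ C R, Mstar C R =
      (-1 : ℚ) ^ (r - ((R : Finset (Fin n)) ∩ (C : Finset (Fin n))).card) *
        ((c - ((R : Finset (Fin n)) ∩ (C : Finset (Fin n))).card - 1).choose
            (r - ((R : Finset (Fin n)) ∩ (C : Finset (Fin n))).card) : ℚ) /
        (((n - r).choose (c - r) : ℚ) *
          ((n - c).choose (r - ((R : Finset (Fin n)) ∩ (C : Finset (Fin n))).card) : ℚ))) :
    M * Mstar = 1 := by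
  classical
  ext R R'
  obtain ⟨R, hR⟩ := R
  obtain ⟨R', hR'⟩ := R'
  have hinter : (R' ∩ R).card + (R' \ R).card = r := by
    rw [Finset.card_inter_add_card_sdiff, hR']
  have hdisj : Disjoint (R' \ R) (R ∪ R')ᶜ :=
    Finset.disjoint_left.2 fun x hx hx' => by
      simp only [Finset.mem_sdiff, Finset.mem_compl, Finset.mem_union] at hx hx'
      tauto
  have hunion : R' \ R ∪ (R ∪ R')ᶜ = Rᶜ := by
    ext x
    simp only [Finset.mem_sdiff, Finset.mem_compl, Finset.mem_union]
    tauto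
  have hcompl : ((R ∪ R')ᶜ).card = n - r - (R' \ R).card := by
    rw [Finset.card_compl, Fintype.card_fin, ← Finset.union_sdiff_self_eq_union,
      Finset.card_union_of_disjoint Finset.disjoint_sdiff, hR, Nat.sub_sub]
  set j := (R' \ R).card with hj
  set weight : ℕ → ℚ := fun i => (-1 : ℚ) ^ (r - i) * ((c - i - 1).choose (r - i) : ℚ) /
    (((n - r).choose (c - r) : ℚ) * ((n - c).choose (r - i) : ℚ)) with hweight
  have entry : (M * Mstar) ⟨R, hR⟩ ⟨R', hR'⟩ =
      ∑ C ∈ (Finset.powersetCard c Finset.univ).filter (R ⊆ ·), weight (R' ∩ C).card := by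
    rw [Matrix.mul_apply, Finset.sum_filter,
      Finset.sum_subtype (p := fun S : Finset (Fin n) => S.card = c) _ (by simp)]
    refine Finset.sum_congr rfl fun C _ => ?_
    rw [hM, hMstar, ite_mul, one_mul, zero_mul]
  have trace : ∀ D ∈ Finset.powersetCard (c - r) Rᶜ,
      weight (R' ∩ (R ∪ D)).card = weight ((R' ∩ R).card + ((R' \ R) ∩ D).card) := by
    intro D hD
    have hD' := Finset.disjoint_left.1
      (Finset.subset_compl_iff_disjoint_left.1 (Finset.mem_powersetCard.1 hD).1)
    rw [← Finset.card_union_of_disjoint]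
    · congr 2
      grind
    · exact Finset.disjoint_left.2 fun x hx hx' => by grind
  rw [entry, sum_filter_superset_eq_sum_powersetCard_compl R (by omega), hR,
    Finset.sum_congr rfl trace, ← hunion,
    sum_powersetCard_union_card_inter hdisj (c - r) fun a => weight ((R' ∩ R).card + a),
    hcompl, ← hj]
  have total := sum_antidiagonal_choose_mul_choose_mul_weight
    (m := n - r) (d := c - r) (j := j) (by omega)
  have hone : (1 : Matrix {S : Finset (Fin n) // S.card = r}
      {S : Finset (Fin n) // S.card = r} ℚ) ⟨R, hR⟩ ⟨R', hR'⟩ =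
      if j = 0 then 1 else 0 := by
    rw [Matrix.one_apply]
    congr 1
    rw [Subtype.mk.injEq, hj, Finset.card_eq_zero, Finset.sdiff_eq_empty_iff_subset]
    exact propext ⟨fun h => h.ge, fun h => (Finset.eq_of_subset_of_card_le h (by omega)).symm⟩
  rw [hone, ← total]
  refine Finset.sum_congr rfl fun p _ => ?_
  rcases Nat.lt_or_ge j p.1 with hp | hp
  · simp [Nat.choose_eq_zero_of_lt hp]
  · rw [hweight]
    simp only
    rw [show r - ((R' ∩ R).card + p.1) = j - p.1 by omega,
      show c - ((R' ∩ R).card + p.1) - 1 = c - r + (j - p.1) - 1 by omega,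
      show n - r - (c - r) = n - c by omega]
end

section
/- Let r, c, n be integers with 0 ≤ r ≤ c ≤ n and n ≤ r + c. Let M be the C(n,r) × C(n,c) matrix over ℚ whose rows are indexed by r-element subsets R of {1,…,n} and columns by c-element subsets C of {1,…,n}, with (R,C)-entry equal to 1 if R ⊆ C and 0 otherwise. Let M* be the C(n,c) × C(n,r) matrix over ℚ whose (C,R)-entry equals (-1)^{r-i} · C(c-i-1, r-i) / ( C(c, c-r) · C(r, r-i) ), where i = |R ∩ C|. Then M*·M is the identity matrix of size C(n,c). -/
open Finset in
/-- The alternating binomial sum of a binomial polynomial of smaller degree vanishes. -/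
theorem sum_neg_one_pow_mul_choose_mul_add_choose (a p : ℕ) :
    ∑ j ∈ range (p + 2), (-1 : ℚ) ^ j * ((p + 1).choose j : ℚ) * ((a + j).choose p : ℚ) = 0 := by
  have hdiff : (fwdDiff 1)^[p + 1] (fun x ↦ x.choose p : ℕ → ℤ) a = 0 := by
    have hconst := fwdDiff_iter_choose 0 p
    rw [add_zero] at hconst
    rw [Function.iterate_succ_apply', hconst]
    simp [fwdDiff]
  rw [fwdDiff_iter_eq_sum_shift] at hdiff
  have hcast := congrArg (fun z : ℤ ↦ (-1 : ℚ) ^ (p + 1) * (z : ℚ)) hdiff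
  simp only [Int.cast_sum, mul_sum, Int.cast_zero, mul_zero] at hcast
  rw [← hcast]
  refine sum_congr rfl fun j hj ↦ ?_
  have hjp : j ≤ p + 1 := Nat.lt_succ_iff.mp (mem_range.mp hj)
  have hsign : (-1 : ℚ) ^ (p + 1) * (-1) ^ (p + 1 - j) = (-1) ^ j := by
    nth_rewrite 1 [← Nat.add_sub_of_le hjp]
    rw [pow_add, mul_assoc, ← mul_pow]
    simp
  push_cast [smul_eq_mul, mul_one]
  rw [← hsign]
  ring

open Nat in
theorem choose_mul_choose_div_choose_eq {r e p j : ℕ} (hp : p ≤ r + e) (hj : j ≤ r) :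
    ((r + e - p).choose (r - j) : ℚ) * ((e + j).choose j : ℚ) / (r.choose j : ℚ) =
      ((r + e - p)! * p ! : ℚ) / (r ! * e !) * ((e + j).choose p : ℚ) := by
  rcases lt_or_ge (e + j) p with hlt | hge
  · rw [Nat.choose_eq_zero_of_lt (show r + e - p < r - j by omega),
      Nat.choose_eq_zero_of_lt hlt]
    simp
  · obtain ⟨q, hq⟩ := Nat.exists_eq_add_of_le hge
    obtain ⟨s, rfl⟩ := Nat.exists_eq_add_of_le hj
    have hsq : j + s + e - p = s + q := by omega
    have hmid : ((e + j).choose j : ℚ) = (e + j)! / (j ! * e !) := by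
      rw [Nat.add_comm e j, Nat.cast_add_choose]
    have hright : ((e + j).choose p : ℚ) = (e + j)! / (p ! * q !) := by
      rw [hq, Nat.cast_add_choose]
    rw [hsq, Nat.add_sub_cancel_left, hmid, hright, Nat.cast_add_choose, Nat.cast_add_choose]
    have hfact (k : ℕ) : (k ! : ℚ) ≠ 0 := mod_cast k.factorial_ne_zero
    have := hfact j
    have := hfact s
    have := hfact e
    have := hfact p
    have := hfact q
    have := hfact (e + j)
    have := hfact (j + s)
    have := hfact (s + q)
    field_simp

open Finset in
/-- Subsets of `D` of size `r` with `j` elements outside `C`, counted by their two parts. -/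
theorem card_filter_powersetCard_card_sdiff {α : Type*} [DecidableEq α] (C D : Finset α)
    {r j : ℕ} (hj : j ≤ r) :
    #{R ∈ powersetCard r D | #(R \ C) = j} = (#(D \ C)).choose j * (#(D ∩ C)).choose (r - j) := by
  rw [← card_powersetCard, ← card_powersetCard, ← card_product]
  refine card_nbij' (fun R ↦ (R \ C, R ∩ C)) (fun P ↦ P.1 ∪ P.2) ?_ ?_ ?_ ?_
  · intro R hR
    simp only [coe_filter, Set.mem_ofPred_eq, mem_powersetCard] at hR
    obtain ⟨⟨hRD, hcard⟩, hout⟩ := hR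
    have := card_sdiff_add_card_inter R C
    simp only [coe_product, Set.mem_prod, mem_coe, mem_powersetCard]
    exact ⟨⟨sdiff_subset_sdiff hRD subset_rfl, hout⟩, inter_subset_inter_right hRD, by omega⟩
  · rintro ⟨A, B⟩ hAB
    simp only [coe_product, Set.mem_prod, mem_coe, mem_powersetCard] at hAB
    obtain ⟨⟨hA, hAcard⟩, hB, hBcard⟩ := hAB
    rw [subset_sdiff] at hA
    rw [subset_inter_iff] at hB
    have hdisj : Disjoint A B := disjoint_of_subset_right hB.2 hA.2
    simp only [coe_filter, Set.mem_ofPred_eq, mem_powersetCard]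
    refine ⟨⟨union_subset hA.1 hB.1, ?_⟩, ?_⟩
    · rw [card_union_of_disjoint hdisj]
      omega
    · rw [union_sdiff_distrib, sdiff_eq_empty_iff_subset.mpr hB.2, union_empty,
        sdiff_eq_self_of_disjoint hA.2, hAcard]
  · intro R _
    exact sdiff_union_inter R C
  · rintro ⟨A, B⟩ hAB
    simp only [coe_product, Set.mem_prod, mem_coe, mem_powersetCard] at hAB
    obtain ⟨⟨hA, -⟩, hB, -⟩ := hAB
    rw [subset_sdiff] at hA
    rw [subset_inter_iff] at hB
    have hdisj := disjoint_left.mp hA.2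
    have hBC := hB.2
    ext x <;> grind

open Finset in
theorem sum_powersetCard_card_sdiff {α : Type*} [DecidableEq α] (C D : Finset α)
    {r : ℕ} (hr : #(D \ C) ≤ r) (f : ℕ → ℚ) :
    ∑ R ∈ powersetCard r D, f #(R \ C) =
      ∑ j ∈ range (#(D \ C) + 1),
        ((#(D \ C)).choose j : ℚ) * ((#(D ∩ C)).choose (r - j) : ℚ) * f j := by
  have hmaps : ∀ R ∈ powersetCard r D, #(R \ C) ∈ range (#(D \ C) + 1) := fun R hR ↦
    mem_range.mpr <| Nat.lt_succ_of_le <|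
      card_le_card (sdiff_subset_sdiff (mem_powersetCard.mp hR).1 subset_rfl)
  rw [← sum_fiberwise_of_maps_to hmaps]
  refine sum_congr rfl fun j hj ↦ ?_
  have hjr : j ≤ r := (Nat.lt_succ_iff.mp (mem_range.mp hj)).trans hr
  rw [sum_congr rfl fun R hR ↦ congrArg f (mem_filter.mp hR).2, sum_const,
    card_filter_powersetCard_card_sdiff C D hjr, nsmul_eq_mul]
  push_cast
  rfl

open Finset in
theorem sum_choose_mul_star_coeff_eq_zero {r c m : ℕ} (hrc : r ≤ c) (hm : m ≠ 0) (hmr : m ≤ r) :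
    ∑ j ∈ range (m + 1), (m.choose j : ℚ) * ((c - m).choose (r - j) : ℚ) *
      ((-1 : ℚ) ^ j * ((c - (r - j) - 1).choose j : ℚ) /
        ((c.choose (c - r) : ℚ) * (r.choose j : ℚ))) = 0 := by
  obtain ⟨p, rfl⟩ := Nat.exists_eq_succ_of_ne_zero hm
  rcases hrc.eq_or_lt with rfl | hlt
  · refine sum_eq_zero fun j hj ↦ ?_
    have hjp := mem_range.mp hj
    rcases Nat.eq_zero_or_pos j with rfl | hpos
    · rw [Nat.choose_eq_zero_of_lt (show r - (p + 1) < r - 0 by omega)]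
      simp
    · rw [Nat.choose_eq_zero_of_lt (show r - (r - j) - 1 < j by omega)]
      simp
  · obtain ⟨e, rfl⟩ := Nat.exists_eq_add_of_lt hlt
    have hsum := sum_neg_one_pow_mul_choose_mul_add_choose e p
    rw [← mul_zero (((r + e - p).factorial * p.factorial : ℚ) / (r.factorial * e.factorial) /
      ((r + e + 1).choose (r + e + 1 - r) : ℚ)), ← hsum, mul_sum]
    refine sum_congr rfl fun j hj ↦ ?_
    have hjp := mem_range.mp hj
    have hterm := choose_mul_choose_div_choose_eq (r := r) (e := e) (p := p) (j := j)
      (by omega) (by omega)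
    rw [show r + e + 1 - (p + 1) = r + e - p by omega,
      show r + e + 1 - (r - j) - 1 = e + j by omega]
    calc _ = ((-1 : ℚ) ^ j * ((p + 1).choose j : ℚ) /
            ((r + e + 1).choose (r + e + 1 - r) : ℚ)) *
          (((r + e - p).choose (r - j) : ℚ) * ((e + j).choose j : ℚ) / (r.choose j : ℚ)) := by
            simp only [Nat.succ_eq_add_one]
            ring
      _ = _ := by
            rw [hterm]
            ring

/-- Let `0 ≤ r ≤ c ≤ n` with `n ≤ r + c`.  Let `M` be the set inclusion incidence matrix,
whose rows are indexed by `r`-subsets `R` of `{1,…,n}` and whose columns are indexed by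
`c`-subsets `C`, with `(R,C)`-entry `1` if `R ⊆ C` and `0` otherwise.  Let `M*` be the matrix
with `(C,R)`-entry `(-1)^(r-i) · C(c-i-1, r-i) / (C(c, c-r) · C(r, r-i))`, where
`i = |R ∩ C|`.  Then `M* · M = I`. -/
theorem star_mul_set_inclusion_eq_one (r c n : ℕ) (hrc : r ≤ c) (hcn : c ≤ n)
    (hn : n ≤ r + c)
    (M : Matrix {S : Finset (Fin n) // S.card = r} {S : Finset (Fin n) // S.card = c} ℚ)
    (hM : ∀ R C, M R C = if (R : Finset (Fin n)) ⊆ (C : Finset (Fin n)) then 1 else 0)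
    (Mstar : Matrix {S : Finset (Fin n) // S.card = c} {S : Finset (Fin n) // S.card = r} ℚ)
    (hMstar : ∀ C R, Mstar C R =
      (-1 : ℚ) ^ (r - ((R : Finset (Fin n)) ∩ (C : Finset (Fin n))).card) *
        ((c - ((R : Finset (Fin n)) ∩ (C : Finset (Fin n))).card - 1).choose
            (r - ((R : Finset (Fin n)) ∩ (C : Finset (Fin n))).card) : ℚ) /
        ((c.choose (c - r) : ℚ) *
          (r.choose (r - ((R : Finset (Fin n)) ∩ (C : Finset (Fin n))).card) : ℚ))) :
    Mstar * M = 1 := by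
  classical
  ext C D
  obtain ⟨C, hC⟩ := C
  obtain ⟨D, hD⟩ := D
  set f : ℕ → ℚ := fun j ↦ (-1 : ℚ) ^ j * ((c - (r - j) - 1).choose j : ℚ) /
    ((c.choose (c - r) : ℚ) * (r.choose j : ℚ)) with hf
  have hentry (R : {S : Finset (Fin n) // S.card = r}) :
      Mstar ⟨C, hC⟩ R = f ((R : Finset (Fin n)) \ C).card := by
    have hsplit := Finset.card_sdiff_add_card_inter (R : Finset (Fin n)) C
    rw [R.2] at hsplit
    rw [hMstar, hf]
    simp only
    rw [show r - ((R : Finset (Fin n)) ∩ C).card = ((R : Finset (Fin n)) \ C).card by omega,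
      show r - ((R : Finset (Fin n)) \ C).card = ((R : Finset (Fin n)) ∩ C).card by omega]
  have hsum : (Mstar * M) ⟨C, hC⟩ ⟨D, hD⟩ =
      ∑ R ∈ Finset.powersetCard r D, f (R \ C).card := by
    simp only [Matrix.mul_apply, hentry, hM, mul_ite, mul_one, mul_zero]
    rw [← Finset.sum_filter]
    refine Finset.sum_bij (fun R _ ↦ (R : Finset (Fin n))) ?_ ?_ ?_ ?_
    · intro R hR
      exact Finset.mem_powersetCard.mpr ⟨(Finset.mem_filter.mp hR).2, R.2⟩
    · intro R _ R' _ h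
      exact Subtype.ext h
    · intro R hR
      obtain ⟨hsub, hcard⟩ := Finset.mem_powersetCard.mp hR
      exact ⟨⟨R, hcard⟩, Finset.mem_filter.mpr ⟨Finset.mem_univ _, hsub⟩, rfl⟩
    · intro R _
      rfl
  have hunion : (D \ C).card + C.card ≤ n := by
    rw [Finset.card_sdiff_add_card]
    simpa using Finset.card_le_univ (D ∪ C)
  have hsplit := Finset.card_sdiff_add_card_inter D C
  have hout : (D \ C).card ≤ r := by omega
  rw [hsum, sum_powersetCard_card_sdiff C D hout,
    show (D ∩ C).card = c - (D \ C).card by omega]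
  by_cases hCD : C = D
  · subst hCD
    have hpos : (c.choose r : ℚ) ≠ 0 := mod_cast (Nat.choose_pos hrc).ne'
    simp [hf, Nat.choose_symm hrc, hpos]
  · rw [Matrix.one_apply_ne (by simpa using hCD)]
    refine sum_choose_mul_star_coeff_eq_zero hrc (fun hzero ↦ hCD ?_) hout
    rw [Finset.card_eq_zero, Finset.sdiff_eq_empty_iff_subset] at hzero
    exact (Finset.eq_of_subset_of_card_le hzero (by omega)).symm
end

section
/- Let r, c, n be integers with 0 ≤ r ≤ c ≤ n, and set N = max{n, r+c}. Let M be the C(n,r) × C(n,c) matrix over ℚ whose rows are indexed by r-element subsets R of {1,…,n} and columns by c-element subsets C of {1,…,n}, with (R,C)-entry equal to 1 if R ⊆ C and 0 otherwise. Let M* be the C(n,c) × C(n,r) matrix over ℚ whose (C,R)-entry equals (-1)^{r-i} · C(c-i-1, r-i) / ( C(N-r, c-r) · C(N-c, r-i) ), where i = |R ∩ C|. Then M* is the Moore-Penrose inverse of M; that is, M·M*·M = M, M*·M·M* = M*, (M·M*)ᵀ = M·M*, and (M*·M)ᵀ = M*·M. -/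
open Matrix

open Finset in
/-- Sorting the `t`-subsets `S` of `U` by the size of `S ∩ A`. -/
theorem sum_powersetCard_card_inter {α : Type*} [DecidableEq α] (U A : Finset α) (t : ℕ)
    (g : ℕ → ℚ) :
    ∑ S ∈ U.powersetCard t, g (S ∩ A).card =
      ∑ p ∈ HasAntidiagonal.antidiagonal t, ((U ∩ A).card.choose p.1 : ℚ) *
        ((U.card - (U ∩ A).card).choose p.2 : ℚ) * g p.1 := by
  have hU : U.card - (U ∩ A).card = (U \ A).card := by
    have := card_inter_add_card_sdiff U A
    omega
  have hmaps : ∀ S ∈ U.powersetCard t, ((S ∩ A).card, (S \ A).card) ∈ HasAntidiagonal.antidiagonal t := by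
    intro S hS
    rw [HasAntidiagonal.mem_antidiagonal, card_inter_add_card_sdiff, (mem_powersetCard.1 hS).2]
  rw [← sum_fiberwise_of_maps_to hmaps]
  refine sum_congr rfl fun p hp => ?_
  rw [HasAntidiagonal.mem_antidiagonal] at hp
  have hcard : (U.powersetCard t |>.filter fun S => ((S ∩ A).card, (S \ A).card) = p).card =
      (U ∩ A).card.choose p.1 * (U \ A).card.choose p.2 := by
    rw [← card_powersetCard, ← card_powersetCard, ← card_product]
    refine card_nbij' (fun S => (S ∩ A, S \ A)) (fun Q => Q.1 ∪ Q.2) ?_ ?_ ?_ ?_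
    · intro S hS
      simp only [coe_filter, Set.mem_ofPred_eq, mem_powersetCard] at hS
      simp only [coe_product, Set.mem_prod, mem_coe, mem_powersetCard, ← hS.2, and_true]
      exact ⟨inter_subset_inter_right hS.1.1, sdiff_subset_sdiff hS.1.1 subset_rfl⟩
    · rintro ⟨Q, T⟩ hQ
      simp only [coe_product, Set.mem_prod, mem_coe, mem_powersetCard] at hQ
      obtain ⟨⟨hQ, hQc⟩, hT, hTc⟩ := hQ
      have h₁ : (Q ∪ T) ∩ A = Q := by grind
      have h₂ : (Q ∪ T) \ A = T := by grind
      simp only [coe_filter, Set.mem_ofPred_eq, mem_powersetCard, h₁, h₂, hQc, hTc, and_true]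
      refine ⟨by grind, ?_⟩
      rw [← card_inter_add_card_sdiff (Q ∪ T) A, h₁, h₂, hQc, hTc, hp]
    · intro S _
      simp only
      grind
    · rintro ⟨Q, T⟩ hQ
      simp only [coe_product, Set.mem_prod, mem_coe, mem_powersetCard] at hQ
      ext <;> grind
  rw [sum_congr rfl (g := fun _ => g p.1), sum_const, hcard, hU, nsmul_eq_mul]
  · push_cast
    ring
  · intro S hS
    rw [← (mem_filter.1 hS).2]

/-- The `(e + 1)`-st finite difference of a polynomial of degree `e` vanishes. -/
theorem alternating_sum_choose_mul_choose_add (e a : ℕ) :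
    ∑ s ∈ Finset.range (e + 2), (-1 : ℚ) ^ s * ((e + 1).choose s : ℚ) * ((a + s).choose e : ℚ)
      = 0 := by
  have h := fwdDiff_iter_eq_sum_shift (1 : ℕ) (fun x => (x.choose e : ℤ)) (e + 1) a
  have h0 : (fwdDiff (1 : ℕ))^[e + 1] (fun x => (x.choose e : ℤ)) = fun _ => 0 := by
    have := fwdDiff_iter_choose 0 e
    rw [Function.iterate_succ_apply']
    simp only [add_zero] at this
    rw [this]
    simp
  rw [h0] at h
  have h' : (∑ k ∈ Finset.range (e + 2),
      ((-1 : ℚ) ^ (e + 1 - k) * ((e + 1).choose k : ℚ)) * ((a + k).choose e : ℚ)) = 0 := by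
    have := congrArg (Int.cast : ℤ → ℚ) h.symm
    push_cast [smul_eq_mul, mul_one] at this
    simpa using this
  have h2 := congrArg (fun x => (-1 : ℚ) ^ (e + 1) * x) h'
  simp only [mul_zero, Finset.mul_sum] at h2
  rw [← h2]
  refine Finset.sum_congr rfl fun s hs => ?_
  have hs : s ≤ e + 1 := by simpa [Nat.lt_succ_iff] using hs
  obtain ⟨k, hk⟩ := Nat.exists_eq_add_of_le hs
  rw [hk, Nat.add_sub_cancel_left, pow_add]
  have : (-1 : ℚ) ^ k * (-1) ^ k = 1 := by rw [← mul_pow]; simp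
  linear_combination (-((-1 : ℚ) ^ s * ((s + k).choose s : ℚ) * ((a + s).choose e : ℚ))) * this

theorem choose_mul_choose_mul_factorial (t m e s : ℕ) (hst : s ≤ t) (het : e ≤ t) :
    (t + m - e).choose (t - s) * (m + s).choose s * (t.factorial * m.factorial) =
      t.choose s * (m + s).choose e * ((t + m - e).factorial * e.factorial) := by
  rcases lt_or_ge (m + s) e with h | h
  · rw [Nat.choose_eq_zero_of_lt h, Nat.choose_eq_zero_of_lt (by omega)]
    simp
  · obtain ⟨k, rfl⟩ := Nat.exists_eq_add_of_le hst
    obtain ⟨l, hl⟩ := Nat.exists_eq_add_of_le h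
    have h₁ : s + k + m - e = k + l := by omega
    rw [h₁, Nat.add_sub_cancel_left]
    have e₁ := Nat.add_choose_mul_factorial_mul_factorial k l
    have e₂ := Nat.add_choose_mul_factorial_mul_factorial m s
    have e₃ := Nat.add_choose_mul_factorial_mul_factorial s k
    have e₄ := Nat.add_choose_mul_factorial_mul_factorial e l
    rw [← Nat.choose_symm_add] at e₁ e₃ e₄
    rw [← hl] at e₄
    have hk := k.factorial_ne_zero
    have hl := l.factorial_ne_zero
    have hs := s.factorial_ne_zero
    refine Nat.eq_of_mul_eq_mul_right
      (Nat.pos_of_ne_zero (mul_ne_zero (mul_ne_zero hk hl) hs)) ?_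
    calc _ = ((k + l).choose k * k.factorial * l.factorial) *
          ((m + s).choose s * m.factorial * s.factorial) * (s + k).factorial := by ring
      _ = ((s + k).choose s * s.factorial * k.factorial) *
          ((m + s).choose e * e.factorial * l.factorial) * (k + l).factorial := by
        rw [e₁, e₂, e₃, e₄]; ring
      _ = _ := by ring

/-- The entries of the generalized inverse as a function of `s = |R \ C|`, where `m = c - r`
and `t = N - c`. -/
def inclusionWeight (t m s : ℕ) : ℚ :=
  (-1) ^ s * ((m + s - 1).choose s : ℚ) / (((t + m).choose m : ℚ) * (t.choose s : ℚ))

theorem sum_antidiagonal_inclusionWeight (t m e : ℕ) (het : e ≤ t) :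
    ∑ p ∈ Finset.HasAntidiagonal.antidiagonal t, (e.choose p.1 : ℚ) * ((t + m - e).choose p.2 : ℚ) *
      inclusionWeight t m p.1 = if e = 0 then 1 else 0 := by
  rw [Finset.Nat.sum_antidiagonal_eq_sum_range_succ_mk]
  have htm : ((t + m).choose m : ℚ) ≠ 0 :=
    Nat.cast_ne_zero.2 (Nat.choose_pos (Nat.le_add_left m t)).ne'
  rcases e with _ | e
  · rw [Finset.sum_eq_single 0]
    · simp [inclusionWeight, Nat.choose_symm_add (a := t) (b := m), htm]
    · intro s _ hs
      simp [Nat.choose_eq_zero_of_lt (Nat.pos_of_ne_zero hs)]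
    · simp
  rw [if_neg (Nat.succ_ne_zero e)]
  rcases m with _ | m
  · refine Finset.sum_eq_zero fun s _ => ?_
    rcases s with _ | s
    · simp [Nat.choose_eq_zero_of_lt (show t - (e + 1) < t by omega)]
    · simp [inclusionWeight]
  have hf : ((t.factorial * m.factorial : ℕ) : ℚ) ≠ 0 := by positivity
  have key : ∀ s ∈ Finset.range (t + 1),
      ((e + 1).choose s : ℚ) * ((t + (m + 1) - (e + 1)).choose (t - s) : ℚ) *
        inclusionWeight t (m + 1) s =
      (((t + m - e).factorial * e.factorial : ℕ) : ℚ) /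
        ((t.factorial * m.factorial : ℕ) * ((t + (m + 1)).choose (m + 1) : ℚ)) *
        ((-1) ^ s * ((e + 1).choose s : ℚ) * ((m + s).choose e : ℚ)) := by
    intro s hs
    have hst : s ≤ t := by simpa [Nat.lt_succ_iff] using hs
    have hts : (t.choose s : ℚ) ≠ 0 := Nat.cast_ne_zero.2 (Nat.choose_pos hst).ne'
    have h := congrArg (Nat.cast : ℕ → ℚ)
      (choose_mul_choose_mul_factorial t m e s hst (by omega))
    rw [Nat.cast_mul, Nat.cast_mul, Nat.cast_mul (_ * _), Nat.cast_mul (t.choose s)] at h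
    have h₁ : t + (m + 1) - (e + 1) = t + m - e := by omega
    have h₂ : m + 1 + s - 1 = m + s := by omega
    rw [inclusionWeight, h₁, h₂]
    generalize ((t.factorial * m.factorial : ℕ) : ℚ) = x at *
    generalize (((t + m - e).factorial * e.factorial : ℕ) : ℚ) = y at *
    field_simp
    linear_combination ((e + 1).choose s : ℚ) * h
  rw [Finset.sum_congr rfl key, ← Finset.mul_sum]
  refine mul_eq_zero_of_right _ ?_
  rw [← alternating_sum_choose_mul_choose_add e m]
  refine (Finset.sum_subset (Finset.range_subset_range.2 (by omega)) fun s _ hs => ?_).symm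
  rw [Nat.choose_eq_zero_of_lt (show e + 1 < s by rw [Finset.mem_range] at hs; omega)]
  simp

section Inclusion

variable {α : Type*} [DecidableEq α] {r c : ℕ}

theorem card_sdiff_comm_of_card_eq {k : ℕ} (S T : {S : Finset α // S.card = k}) :
    (S.1 \ T.1).card = (T.1 \ S.1).card :=
  Finset.card_sdiff_comm (S.2.trans T.2.symm)

theorem card_sdiff_eq_zero_iff {k : ℕ} (S T : {S : Finset α // S.card = k}) :
    (S.1 \ T.1).card = 0 ↔ S = T := by
  rw [Finset.card_eq_zero, Finset.sdiff_eq_empty_iff_subset, Subtype.ext_iff]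
  exact ⟨fun h => Finset.eq_of_subset_of_card_le h (by rw [S.2, T.2]), fun h => h.subset⟩

variable [Fintype α] (M : Matrix {S : Finset α // S.card = r} {S : Finset α // S.card = c} ℚ)
  (P : Matrix {S : Finset α // S.card = c} {S : Finset α // S.card = r} ℚ) (g : ℕ → ℚ)

theorem mul_inclusion_apply (hM : ∀ R C, M R C = if R.1 ⊆ C.1 then 1 else 0)
    (hP : ∀ C R, P C R = g (R.1 \ C.1).card) (C C' : {S : Finset α // S.card = c}) :
    (P * M) C C' = ∑ p ∈ Finset.HasAntidiagonal.antidiagonal r, ((C'.1 \ C.1).card.choose p.1 : ℚ) *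
      ((c - (C'.1 \ C.1).card).choose p.2 : ℚ) * g p.1 := by
  have h := sum_powersetCard_card_inter C'.1 C.1ᶜ r g
  simp only [← Finset.sdiff_eq_inter_compl, C'.2] at h
  rw [← h, Matrix.mul_apply]
  simp only [hM, hP, mul_ite, mul_one, mul_zero]
  rw [← Finset.sum_filter]
  refine Finset.sum_bij (fun R _ => R.1) ?_ ?_ ?_ ?_
  · intro R hR
    exact Finset.mem_powersetCard.2 ⟨(Finset.mem_filter.1 hR).2, R.2⟩
  · intro R _ R' _ hRR
    exact Subtype.ext hRR
  · intro S hS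
    rw [Finset.mem_powersetCard] at hS
    exact ⟨⟨S, hS.2⟩, by simpa using hS.1, rfl⟩
  · intro R _
    rfl

theorem inclusion_mul_apply (hM : ∀ R C, M R C = if R.1 ⊆ C.1 then 1 else 0)
    (hP : ∀ C R, P C R = g (R.1 \ C.1).card) (hc : c ≤ Fintype.card α)
    (R R' : {S : Finset α // S.card = r}) :
    (M * P) R R' = ∑ p ∈ Finset.HasAntidiagonal.antidiagonal (Fintype.card α - c),
      ((R'.1 \ R.1).card.choose p.1 : ℚ) *
      ((Fintype.card α - r - (R'.1 \ R.1).card).choose p.2 : ℚ) * g p.1 := by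
  have h := sum_powersetCard_card_inter R.1ᶜ R'.1 (Fintype.card α - c) g
  have hR : R.1ᶜ ∩ R'.1 = R'.1 \ R.1 := by
    rw [Finset.inter_comm, Finset.sdiff_eq_inter_compl]
  rw [hR, Finset.card_compl, R.2] at h
  rw [← h, Matrix.mul_apply]
  simp only [hM, hP, ite_mul, one_mul, zero_mul]
  rw [← Finset.sum_filter]
  refine Finset.sum_bij (fun C _ => C.1ᶜ) ?_ ?_ ?_ ?_
  · intro C hC
    refine Finset.mem_powersetCard.2 ⟨?_, by rw [Finset.card_compl, C.2]⟩
    exact Finset.compl_subset_compl.2 (Finset.mem_filter.1 hC).2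
  · intro C _ C' _ hCC
    exact Subtype.ext (compl_injective hCC)
  · intro S hS
    rw [Finset.mem_powersetCard] at hS
    refine ⟨⟨Sᶜ, by rw [Finset.card_compl, hS.2]; omega⟩, ?_, compl_compl S⟩
    simpa using Finset.subset_compl_comm.1 hS.1
  · intro C _
    rw [Finset.inter_comm, Finset.sdiff_eq_inter_compl]

end Inclusion

/-- Let `0 ≤ r ≤ c ≤ n` and `N = max{n, r+c}`.  Let `M` be the set inclusion incidence
matrix, with rows indexed by `r`-subsets `R` of `{1,…,n}`, columns indexed by `c`-subsets
`C`, and `(R,C)`-entry `1` if `R ⊆ C` and `0` otherwise.  Let `M*` have `(C,R)`-entry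
`(-1)^(r-i) · C(c-i-1, r-i) / (C(N-r, c-r) · C(N-c, r-i))` where `i = |R ∩ C|`.
Then `M*` is the Moore-Penrose inverse of `M`: `M·M*·M = M`, `M*·M·M* = M*`,
`(M·M*)ᵀ = M·M*`, and `(M*·M)ᵀ = M*·M`. -/
theorem set_inclusion_moore_penrose (r c n : ℕ) (hrc : r ≤ c) (hcn : c ≤ n)
    (N : ℕ) (hN : N = max n (r + c))
    (M : Matrix {S : Finset (Fin n) // S.card = r} {S : Finset (Fin n) // S.card = c} ℚ)
    (hM : ∀ R C, M R C = if (R : Finset (Fin n)) ⊆ (C : Finset (Fin n)) then 1 else 0)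
    (Mstar : Matrix {S : Finset (Fin n) // S.card = c} {S : Finset (Fin n) // S.card = r} ℚ)
    (hMstar : ∀ C R, Mstar C R =
      (-1 : ℚ) ^ (r - ((R : Finset (Fin n)) ∩ (C : Finset (Fin n))).card) *
        ((c - ((R : Finset (Fin n)) ∩ (C : Finset (Fin n))).card - 1).choose
            (r - ((R : Finset (Fin n)) ∩ (C : Finset (Fin n))).card) : ℚ) /
        (((N - r).choose (c - r) : ℚ) *
          ((N - c).choose (r - ((R : Finset (Fin n)) ∩ (C : Finset (Fin n))).card) : ℚ))) :
    M * Mstar * M = M ∧ Mstar * M * Mstar = Mstar ∧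
      (M * Mstar)ᵀ = M * Mstar ∧ (Mstar * M)ᵀ = Mstar * M := by

  have hP : ∀ C R, Mstar C R = inclusionWeight (N - c) (c - r) (R.1 \ C.1).card := by
    intro C R
    have h := Finset.card_inter_add_card_sdiff R.1 C.1
    rw [R.2] at h
    have h₁ : r - (R.1 ∩ C.1).card = (R.1 \ C.1).card := by omega
    have h₂ : c - (R.1 ∩ C.1).card - 1 = c - r + (R.1 \ C.1).card - 1 := by omega
    have h₃ : N - c + (c - r) = N - r := by omega
    rw [hMstar, inclusionWeight, h₁, h₂, h₃]
  have hMP := inclusion_mul_apply M Mstar _ hM hP (by simpa using hcn)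
  have hPM := mul_inclusion_apply M Mstar _ hM hP
  rw [Fintype.card_fin] at hMP
  have hMPt : (M * Mstar)ᵀ = M * Mstar := by
    ext R R'
    rw [transpose_apply, hMP, hMP, card_sdiff_comm_of_card_eq R R']
  have hPMt : (Mstar * M)ᵀ = Mstar * M := by
    ext C C'
    rw [transpose_apply, hPM, hPM, card_sdiff_comm_of_card_eq C C']
  rcases le_total (r + c) n with h | h
  · have hone : M * Mstar = 1 := by
      ext R R'
      have hd : (R'.1 \ R.1).card ≤ n - c :=
        (Finset.card_le_card Finset.sdiff_subset).trans (by rw [R'.2]; omega)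
      have hNn : N - c = n - c := by omega
      have hnr : n - r = n - c + (c - r) := by omega
      rw [hMP, hNn, hnr, sum_antidiagonal_inclusionWeight _ _ _ hd, one_apply,
        card_sdiff_comm_of_card_eq R' R]
      simp only [card_sdiff_eq_zero_iff]
    refine ⟨by rw [hone, Matrix.one_mul], ?_, hMPt, hPMt⟩
    rw [Matrix.mul_assoc, hone, Matrix.mul_one]
  · have hone : Mstar * M = 1 := by
      ext C C'
      have hd : (C'.1 \ C.1).card ≤ r := by
        have h₁ : (C'.1 \ C.1).card ≤ C.1ᶜ.card :=
          Finset.card_le_card (Finset.sdiff_eq_inter_compl C'.1 C.1 ▸ Finset.inter_subset_right)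
        rw [Finset.card_compl, C.2, Fintype.card_fin] at h₁
        omega
      have hNr : N - c = r := by omega
      have hcr : r + (c - r) = c := by omega
      have hsum := sum_antidiagonal_inclusionWeight r (c - r) _ hd
      rw [hcr] at hsum
      rw [hPM, hNr, hsum, one_apply, card_sdiff_comm_of_card_eq C' C]
      simp only [card_sdiff_eq_zero_iff]
    refine ⟨?_, by rw [hone, Matrix.one_mul], hMPt, hPMt⟩
    rw [Matrix.mul_assoc, hone, Matrix.mul_one]
end

section
/- Let r, c, n be integers with 0 ≤ r ≤ c ≤ n, and set N = max{n, r+c}. Let M be the set inclusion incidence matrix over ℚ whose rows are indexed by r-element subsets R of {1,…,n} and columns by c-element subsets C of {1,…,n}, with (R,C)-entry 1 if R ⊆ C and 0 otherwise, and let M* be the matrix whose (C,R)-entry equals (-1)^{r-i} · C(c-i-1, r-i) / ( C(N-r, c-r) · C(N-c, r-i) ) where i = |R ∩ C|. Then both M·M* and M*·M are symmetric matrices. -/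
open Matrix

/-- Two finite sets of the same size are interchanged by some permutation. -/
lemma exists_perm_map_eq_and_map_eq {α : Type*} [Fintype α] [DecidableEq α] {A B : Finset α}
    (h : A.card = B.card) :
    ∃ σ : Equiv.Perm α, A.map σ.toEmbedding = B ∧ B.map σ.toEmbedding = A := by
  have hsdiff : (A \ B).card = (B \ A).card := Finset.card_sdiff_comm h
  have hfiber : ∀ p : Bool × Bool,
      Nonempty ({a // (decide (a ∈ A), decide (a ∈ B)) = p} ≃
        {a // (decide (a ∈ B), decide (a ∈ A)) = p}) := by
    intro p
    refine Fintype.card_eq.mp ?_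
    rw [Fintype.card_subtype, Fintype.card_subtype]
    rcases p with ⟨_ | _, _ | _⟩
    · simp [and_comm]
    · convert hsdiff.symm using 2 <;> ext a <;> simp [and_comm]
    · convert hsdiff using 2 <;> ext a <;> simp
    · simp [and_comm]
  let e := fun p => (hfiber p).some
  obtain ⟨σ, hσ⟩ : ∃ σ : Equiv.Perm α, ∀ a, (σ a ∈ B ↔ a ∈ A) ∧ (σ a ∈ A ↔ a ∈ B) :=
    ⟨Equiv.ofFiberEquiv e, fun a => by simpa using Equiv.ofFiberEquiv_map e a⟩
  refine ⟨σ, ?_, ?_⟩ <;> ext b <;> obtain ⟨a, rfl⟩ := σ.surjective b <;> simp [hσ a]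

/-- A sum over all `k`-subsets of a permutation-invariant function of three sets is symmetric in
two arguments of equal size. -/
lemma sum_card_eq_swap {α β : Type*} [Fintype α] [DecidableEq α] [AddCommMonoid β] (k : ℕ)
    (f : Finset α → Finset α → Finset α → β)
    (hf : ∀ (σ : Equiv.Perm α) A B S,
      f (A.map σ.toEmbedding) (B.map σ.toEmbedding) (S.map σ.toEmbedding) = f A B S)
    {A B : Finset α} (h : A.card = B.card) :
    ∑ S : {S : Finset α // S.card = k}, f A B S = ∑ S : {S : Finset α // S.card = k}, f B A S := by
  obtain ⟨σ, hA, hB⟩ := exists_perm_map_eq_and_map_eq h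
  refine Fintype.sum_equiv
    (σ.finsetCongr.subtypeEquiv fun S => by simp) _ _ fun S => ?_
  rw [← hf σ A B S, hA, hB]
  rfl

/-- Let `0 ≤ r ≤ c ≤ n` and `N = max{n, r+c}`.  Let `M` be the set inclusion incidence
matrix, with rows indexed by `r`-subsets `R` of `{1,…,n}`, columns indexed by `c`-subsets
`C`, and `(R,C)`-entry `1` if `R ⊆ C` and `0` otherwise.  Let `M*` have `(C,R)`-entry
`(-1)^(r-i) · C(c-i-1, r-i) / (C(N-r, c-r) · C(N-c, r-i))` where `i = |R ∩ C|`.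
Then both `M·M*` and `M*·M` are symmetric matrices:
`(M·M*)ᵀ = M·M*` and `(M*·M)ᵀ = M*·M`. -/
theorem set_inclusion_products_symmetric (r c n : ℕ) (hrc : r ≤ c) (hcn : c ≤ n)
    (N : ℕ) (hN : N = max n (r + c))
    (M : Matrix {S : Finset (Fin n) // S.card = r} {S : Finset (Fin n) // S.card = c} ℚ)
    (hM : ∀ R C, M R C = if (R : Finset (Fin n)) ⊆ (C : Finset (Fin n)) then 1 else 0)
    (Mstar : Matrix {S : Finset (Fin n) // S.card = c} {S : Finset (Fin n) // S.card = r} ℚ)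
    (hMstar : ∀ C R, Mstar C R =
      (-1 : ℚ) ^ (r - ((R : Finset (Fin n)) ∩ (C : Finset (Fin n))).card) *
        ((c - ((R : Finset (Fin n)) ∩ (C : Finset (Fin n))).card - 1).choose
            (r - ((R : Finset (Fin n)) ∩ (C : Finset (Fin n))).card) : ℚ) /
        (((N - r).choose (c - r) : ℚ) *
          ((N - c).choose (r - ((R : Finset (Fin n)) ∩ (C : Finset (Fin n))).card) : ℚ))) :
    (M * Mstar)ᵀ = M * Mstar ∧ (Mstar * M)ᵀ = Mstar * M := by
  constructor
  · ext R R'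
    simp only [transpose_apply, mul_apply, hM, hMstar]
    refine sum_card_eq_swap c (fun A B S => (if A ⊆ S then (1 : ℚ) else 0) *
      ((-1 : ℚ) ^ (r - (B ∩ S).card) * ((c - (B ∩ S).card - 1).choose (r - (B ∩ S).card) : ℚ) /
        (((N - r).choose (c - r) : ℚ) * ((N - c).choose (r - (B ∩ S).card) : ℚ)))) ?_
      (R'.2.trans R.2.symm)
    intro σ A B S
    simp only [← Finset.map_inter, Finset.card_map, Finset.map_subset_map]
  · ext C C'
    simp only [transpose_apply, mul_apply, hM, hMstar]
    refine sum_card_eq_swap r (fun A B S => ((-1 : ℚ) ^ (r - (S ∩ A).card) *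
      ((c - (S ∩ A).card - 1).choose (r - (S ∩ A).card) : ℚ) /
        (((N - r).choose (c - r) : ℚ) * ((N - c).choose (r - (S ∩ A).card) : ℚ))) *
      (if S ⊆ B then (1 : ℚ) else 0)) ?_ (C'.2.trans C.2.symm)
    intro σ A B S
    simp only [← Finset.map_inter, Finset.card_map, Finset.map_subset_map]
end

section
/- Let v, k, b, λ₁, λ₂ be positive integers with 2 ≤ k < v. Let B₁, …, B_b be k-element subsets (blocks) of {1,…,v} such that every point of {1,…,v} belongs to exactly λ₁ blocks and every pair of distinct points of {1,…,v} belongs to exactly λ₂ blocks. Let M₁ be the v × b matrix over ℚ with (u, j)-entry equal to 1 if u ∈ B_j and 0 otherwise. Let N be the b × v matrix over ℚ with (j, u)-entry equal to 1/λ₁ if u ∈ B_j and equal to -(k-1)/(λ₁(v-k)) if u ∉ B_j. Then N is the Moore-Penrose inverse of M₁; that is, M₁·N·M₁ = M₁, N·M₁·N = N, (M₁·N)ᵀ = M₁·N, and (N·M₁)ᵀ = N·M₁. -/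
open Matrix

/-- The double counting identity `λ₂ (v - 1) = λ₁ (k - 1)` of a 2-design, over `ℚ`. -/
theorem design_pair_count_mul (v b k lam1 lam2 : ℕ) (hv : 0 < v)
    (B : Fin b → Finset (Fin v)) (hcard : ∀ j, (B j).card = k)
    (hpoint : ∀ u : Fin v, (Finset.univ.filter fun j => u ∈ B j).card = lam1)
    (hpair : ∀ u w : Fin v, u ≠ w →
      (Finset.univ.filter fun j => u ∈ B j ∧ w ∈ B j).card = lam2) :
    (lam2 : ℚ) * ((v : ℚ) - 1) = (lam1 : ℚ) * ((k : ℚ) - 1) := by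
  let u : Fin v := ⟨0, hv⟩
  have hcount : ∑ w : Fin v, (Finset.univ.filter fun j => u ∈ B j ∧ w ∈ B j).card =
      ∑ j ∈ Finset.univ.filter (fun j => u ∈ B j), (B j).card := by
    simp only [← Finset.filter_filter]
    simpa [Finset.bipartiteAbove, Finset.bipartiteBelow] using
      Finset.sum_card_bipartiteAbove_eq_sum_card_bipartiteBelow
        (s := Finset.univ) (t := Finset.univ.filter fun j => u ∈ B j) (fun w j => w ∈ B j)
  have hrow : ∑ w : Fin v, (Finset.univ.filter fun j => u ∈ B j ∧ w ∈ B j).card =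
      lam1 + (v - 1) * lam2 := by
    rw [← Finset.add_sum_erase _ _ (Finset.mem_univ u),
      Finset.sum_congr rfl fun w hw => hpair u w (Finset.ne_of_mem_erase hw).symm]
    simp [hpoint]
  rw [hrow, Finset.sum_congr rfl fun j _ => hcard j, Finset.sum_const, hpoint,
    smul_eq_mul] at hcount
  have hcountQ := congrArg (Nat.cast : ℕ → ℚ) hcount
  push_cast [Nat.cast_sub (Nat.one_le_of_lt hv)] at hcountQ
  linarith

/-- Let `B₁, …, B_b` be `k`-element blocks in `{1,…,v}` (with `2 ≤ k < v`) forming a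
2-design: every point lies in exactly `λ₁` blocks, and every pair of distinct points lies
in exactly `λ₂` blocks.  Let `M₁` be the `v × b` point-block incidence matrix over `ℚ`,
and let `N` be the `b × v` matrix with `(j,u)`-entry `1/λ₁` if `u ∈ B_j` and
`-(k-1)/(λ₁(v-k))` otherwise.  Then `N` is the Moore-Penrose inverse of `M₁`:
`M₁·N·M₁ = M₁`, `N·M₁·N = N`, `(M₁·N)ᵀ = M₁·N`, and `(N·M₁)ᵀ = N·M₁`. -/
theorem design_incidence_moore_penrose (v b k lam1 lam2 : ℕ)
    (hv : 0 < v) (hb : 0 < b) (hlam1 : 0 < lam1) (hlam2 : 0 < lam2)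
    (hk : 2 ≤ k) (hkv : k < v)
    (B : Fin b → Finset (Fin v)) (hcard : ∀ j, (B j).card = k)
    (hpoint : ∀ u : Fin v, (Finset.univ.filter fun j => u ∈ B j).card = lam1)
    (hpair : ∀ u w : Fin v, u ≠ w →
      (Finset.univ.filter fun j => u ∈ B j ∧ w ∈ B j).card = lam2)
    (M₁ : Matrix (Fin v) (Fin b) ℚ)
    (hM₁ : ∀ u j, M₁ u j = if u ∈ B j then 1 else 0)
    (N : Matrix (Fin b) (Fin v) ℚ)
    (hN : ∀ j u, N j u = if u ∈ B j then 1 / (lam1 : ℚ)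
      else -(((k : ℚ) - 1) / ((lam1 : ℚ) * ((v : ℚ) - (k : ℚ))))) :
    M₁ * N * M₁ = M₁ ∧ N * M₁ * N = N ∧ (M₁ * N)ᵀ = M₁ * N ∧ (N * M₁)ᵀ = N * M₁ := by
  have hlam1Q : (lam1 : ℚ) ≠ 0 := by positivity
  have hvk : (v : ℚ) - k ≠ 0 := sub_ne_zero.2 (by exact_mod_cast hkv.ne')
  have hcount := design_pair_count_mul v b k lam1 lam2 hv B hcard hpoint hpair
  set c : ℚ := ((k : ℚ) - 1) / ((lam1 : ℚ) * ((v : ℚ) - (k : ℚ))) with hc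
  have hN_eq (j u) : N j u = (1 / (lam1 : ℚ) + c) * M₁ u j - c := by
    rw [hN, hM₁]
    split_ifs <;> ring
  have hcol (j) : ∑ u, M₁ u j = k := by
    simp [hM₁, hcard]
  have hrow (u) : ∑ j, M₁ u j = lam1 := by
    simp [hM₁, hpoint]
  have hgram (u w) : ∑ j, M₁ u j * M₁ w j = if u = w then (lam1 : ℚ) else lam2 := by
    simp only [hM₁, ite_zero_mul_ite_zero, mul_one, Finset.sum_boole]
    split_ifs with h
    · simp [h, hpoint]
    · rw [hpair u w h]
  have hMN : M₁ * N = 1 := by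
    ext u w
    have hentry : (M₁ * N) u w =
        (1 / (lam1 : ℚ) + c) * ∑ j, M₁ u j * M₁ w j - c * ∑ j, M₁ u j := by
      simp only [Matrix.mul_apply, hN_eq, Finset.mul_sum, ← Finset.sum_sub_distrib]
      exact Finset.sum_congr rfl fun j _ => by ring
    rw [hentry, hgram, hrow, Matrix.one_apply]
    split_ifs
    · field_simp
      ring
    · rw [hc]
      field_simp
      linear_combination hcount
  have hNM : (N * M₁)ᵀ = N * M₁ := by
    have hentry (i j) : (N * M₁) i j =
        (1 / (lam1 : ℚ) + c) * ∑ u, M₁ u i * M₁ u j - c * k := by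
      rw [← hcol j]
      simp only [Matrix.mul_apply, hN_eq, Finset.mul_sum, ← Finset.sum_sub_distrib]
      exact Finset.sum_congr rfl fun u _ => by ring
    ext i j
    simp only [Matrix.transpose_apply, hentry, mul_comm]
  refine ⟨?_, ?_, ?_, hNM⟩
  · rw [hMN, Matrix.one_mul]
  · rw [Matrix.mul_assoc, hMN, Matrix.mul_one]
  · rw [hMN, Matrix.transpose_one]
end
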